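/- There exist universal constants n₀ ∈ ℕ and c > 0 with the following property. Let n ≥ n₀ and let B be an origin-symmetric convex body in ℝⁿ with a smooth boundary in the ℓ-position, and assume E‖G‖_B ≤ n^c · E‖grad_B(G)‖₂, where G is the standard Gaussian vector in ℝⁿ. Then for all p ∈ [1, c·log n], E‖G‖_B^{2p} ≤ n^{1/32} · p² · E(‖G‖_B^{2p−2} · ‖grad_B(G)‖₂²). -/

import Mathlib

open MeasureTheory ProbabilityTheory Real
open scoped ENNReal RealInnerProductSpace

noncomputable section

/-- `ℝⁿ` with the Euclidean structure. -/
abbrev Euc (n : ℕ) := EuclideanSpace ℝ (Fin n)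

/-- An origin-symmetric convex body in `ℝⁿ`: a compact convex set, symmetric about the
origin, with `0` in its interior. -/
def IsSymmConvexBody {n : ℕ} (B : Set (Euc n)) : Prop :=
  IsCompact B ∧ Convex ℝ B ∧ (0 : Euc n) ∈ interior B ∧ ∀ x ∈ B, -x ∈ B

/-- The standard Gaussian measure `γₙ` on `ℝⁿ`. -/
def stdGaussian (n : ℕ) : Measure (Euc n) :=
  (Measure.pi fun _ : Fin n => gaussianReal 0 1).map
    ((EuclideanSpace.equiv (Fin n) ℝ).symm)

/-- `B` is in the ℓ-position: `ℓ(B, Id) = 1` (i.e. `E‖G‖_B² = 1`, where `‖·‖_B = gauge B`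
is the Minkowski functional) and every linear operator `U` with `ℓ(B,U) ≤ 1` has
`|det U| ≤ 1`; together these say `sup{|det U| : ℓ(B,U) ≤ 1} = 1 = det Id`. -/
def IsEllPosition {n : ℕ} (B : Set (Euc n)) : Prop :=
  (∫ x, gauge B x ^ 2 ∂stdGaussian n) = 1 ∧
  ∀ U : Euc n →ₗ[ℝ] Euc n,
    (∫ x, gauge B (U x) ^ 2 ∂stdGaussian n) ≤ 1 → |LinearMap.det U| ≤ 1


lemma half_sub_le_of_subgradient {E : Type*} [NormedAddCommGroup E] [InnerProductSpace ℝ E]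
    (f : Seminorm ℝ E) {g : E → E}
    (hsub : ∀ x y, f x + ⟪g x, y⟫ ≤ f (x + y)) (x y : E) :
    f y / 2 - f x ≤ (-1 : ℝ) * ⟪g y, x⟫ / 2 +
      √2 * ⟪g (ContinuousLinearMap.rotation (π / 4) (x, y)).1,
        (ContinuousLinearMap.rotation (π / 4) (x, y)).2⟫ / 2 := by
  rw [ContinuousLinearMap.rotation_apply]
  simp only [cos_pi_div_four, sin_pi_div_four]
  set U : E := (√2 / 2) • x + (√2 / 2) • y with hU
  set V : E := -(√2 / 2) • x + (√2 / 2) • y with hV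
  have h2 : √2 * √2 = 2 := by norm_num
  have hs : 0 < √2 := by positivity
  have hx : x = (√2 / 2) • (U + -V) := by
    rw [hU, hV]
    have : (√2 / 2) * (√2 / 2) = 1 / 2 := by nlinarith
    simp only [smul_add, smul_neg, neg_smul, smul_smul, this]
    module
  have hUe : U = (√2 / 2) • (y + x) := by rw [hU, smul_add, add_comm]
  have e1 : f x = (√2 / 2) * f (U + -V) := by
    conv_lhs => rw [hx]
    rw [map_smul_eq_mul, norm_eq_abs, abs_of_pos (by positivity)]
  have e2 : f U = (√2 / 2) * f (y + x) := by
    conv_lhs => rw [hUe]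
    rw [map_smul_eq_mul, norm_eq_abs, abs_of_pos (by positivity)]
  have h3 := hsub U (-V)
  have h4 := hsub y x
  rw [inner_neg_right] at h3
  have h5 : (√2 / 2) * (f U + -⟪g U, V⟫) ≤ f x := by rw [e1]; gcongr
  have h6 : (√2 / 2) * (f y + ⟪g y, x⟫) ≤ f U := by rw [e2]; gcongr
  have h7 := mul_le_mul_of_nonneg_left h6 (show 0 ≤ √2 / 2 by positivity)
  have h8 : (√2 / 2) * ((√2 / 2) * (f y + ⟪g y, x⟫)) = (f y + ⟪g y, x⟫) / 2 := by
    linear_combination (f y + ⟪g y, x⟫) / 4 * h2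
  linarith

section GaussianConcentration

variable {E : Type*} [NormedAddCommGroup E] [InnerProductSpace ℝ E] [FiniteDimensional ℝ E]
  [MeasurableSpace E] [BorelSpace E]

lemma map_inner_stdGaussian (v : E) :
    (ProbabilityTheory.stdGaussian E).map (fun x => ⟪v, x⟫) =
      gaussianReal 0 (‖v‖ ^ 2).toNNReal := by
  have h := IsGaussian.map_eq_gaussianReal (μ := ProbabilityTheory.stdGaussian E) (innerSL ℝ v)
  rw [integral_strongDual_stdGaussian, variance_dual_stdGaussian, innerSL_apply_norm] at h
  exact h

lemma lintegral_exp_inner_stdGaussian (v : E) :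
    ∫⁻ x, ENNReal.ofReal (exp ⟪v, x⟫) ∂(ProbabilityTheory.stdGaussian E) =
      ENNReal.ofReal (exp (‖v‖ ^ 2 / 2)) := by
  have h1 : ∫⁻ x, ENNReal.ofReal (exp ⟪v, x⟫) ∂(ProbabilityTheory.stdGaussian E) =
      ∫⁻ t, ENNReal.ofReal (exp t) ∂((ProbabilityTheory.stdGaussian E).map
        (fun x => ⟪v, x⟫)) := by
    rw [lintegral_map (by fun_prop) (by fun_prop)]
  rw [h1, map_inner_stdGaussian, ← ofReal_integral_eq_lintegral_ofReal]
  · have := congrFun (mgf_id_gaussianReal (μ := 0) (v := (‖v‖ ^ 2).toNNReal)) 1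
    simp only [mgf, id, one_mul] at this
    rw [this]
    simp
  · simpa using integrable_exp_mul_gaussianReal (μ := 0) (v := (‖v‖ ^ 2).toNNReal) 1
  · exact ae_of_all _ fun t => (exp_pos t).le

lemma lintegral_exp_inner_le {g : E → E} (hg : Measurable g) {b : ℝ} (hb : ∀ x, ‖g x‖ ≤ b)
    (a : ℝ) :
    ∫⁻ z, ENNReal.ofReal (exp (a * ⟪g z.1, z.2⟫))
      ∂((ProbabilityTheory.stdGaussian E).prod (ProbabilityTheory.stdGaussian E)) ≤
      ENNReal.ofReal (exp (a ^ 2 * b ^ 2 / 2)) := by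
  rw [lintegral_prod _ (by fun_prop)]
  calc _ ≤ ∫⁻ x : E, ENNReal.ofReal (exp (a ^ 2 * b ^ 2 / 2))
        ∂(ProbabilityTheory.stdGaussian E) := by
        refine lintegral_mono fun x => ?_
        have := lintegral_exp_inner_stdGaussian (a • g x)
        simp only [real_inner_smul_left] at this
        simp only [this]
        gcongr
        rw [norm_smul, mul_pow, norm_eq_abs, sq_abs]
        gcongr
        exact hb x
    _ = _ := by simp

lemma map_rotation_stdGaussian :
    ((ProbabilityTheory.stdGaussian E).prod (ProbabilityTheory.stdGaussian E)).map
      (ContinuousLinearMap.rotation (π / 4)) =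
      (ProbabilityTheory.stdGaussian E).prod (ProbabilityTheory.stdGaussian E) :=
  IsGaussian.map_rotation_eq_self (by simp) _

lemma lintegral_exp_mul_lintegral_exp_neg_le (f : Seminorm ℝ E) (hf : Continuous f) {g : E → E}
    (hg : Measurable g) (hsub : ∀ x y, f x + ⟪g x, y⟫ ≤ f (x + y)) {b : ℝ}
    (hb : ∀ x, ‖g x‖ ≤ b) {t : ℝ} (ht : 0 ≤ t) :
    (∫⁻ x, ENNReal.ofReal (exp (-t * f x)) ∂(ProbabilityTheory.stdGaussian E)) *
      (∫⁻ x, ENNReal.ofReal (exp (t / 2 * f x)) ∂(ProbabilityTheory.stdGaussian E)) ≤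
      ENNReal.ofReal (exp (t ^ 2 * b ^ 2)) := by
  have hfm := hf.measurable
  set γ := ProbabilityTheory.stdGaussian E
  rw [← lintegral_prod_mul (by fun_prop) (by fun_prop)]
  set A : E × E → ℝ≥0∞ := fun z => ENNReal.ofReal (exp (-t * ⟪g z.1, z.2⟫)) with hA
  set B : E × E → ℝ≥0∞ := fun z => ENNReal.ofReal (exp (t * √2 * ⟪g z.1, z.2⟫)) with hB
  have hAm : Measurable A := by fun_prop
  have hBm : Measurable B := by fun_prop
  have key : ∀ z : E × E, ENNReal.ofReal (exp (-t * f z.1)) * ENNReal.ofReal (exp (t / 2 * f z.2))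
      ≤ ENNReal.ofReal (1 / 2) * A z.swap +
        ENNReal.ofReal (1 / 2) * B (ContinuousLinearMap.rotation (π / 4) z) := by
    rintro ⟨x, y⟩
    have h := half_sub_le_of_subgradient f hsub x y
    simp only [hA, hB, Prod.swap_prod_mk]
    rw [← ENNReal.ofReal_mul (by positivity), ← ENNReal.ofReal_mul (by positivity),
      ← ENNReal.ofReal_mul (by positivity), ← ENNReal.ofReal_add (by positivity) (by positivity),
      ← exp_add]
    apply ENNReal.ofReal_le_ofReal
    set p := ⟪g y, x⟫
    set q := ⟪g (ContinuousLinearMap.rotation (π / 4) (x, y)).1,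
        (ContinuousLinearMap.rotation (π / 4) (x, y)).2⟫
    have h1 : -t * f x + t / 2 * f y ≤ (-t * p) / 2 + (t * √2 * q) / 2 := by
      have := mul_le_mul_of_nonneg_left h ht
      linarith
    calc exp (-t * f x + t / 2 * f y) ≤ exp ((-t * p) / 2 + (t * √2 * q) / 2) := exp_le_exp.2 h1
      _ = exp ((-t * p) / 2) * exp ((t * √2 * q) / 2) := exp_add _ _
      _ ≤ 1 / 2 * exp (-t * p) + 1 / 2 * exp (t * √2 * q) := by
        have e1 : exp (-t * p) = exp ((-t * p) / 2) ^ 2 := by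
          rw [← exp_nat_mul]; congr 1; push_cast; ring
        have e2 : exp (t * √2 * q) = exp ((t * √2 * q) / 2) ^ 2 := by
          rw [← exp_nat_mul]; congr 1; push_cast; ring
        rw [e1, e2]
        nlinarith [sq_nonneg (exp ((-t * p) / 2) - exp ((t * √2 * q) / 2))]
  calc _ ≤ ∫⁻ z, (ENNReal.ofReal (1 / 2) * A z.swap +
        ENNReal.ofReal (1 / 2) * B (ContinuousLinearMap.rotation (π / 4) z)) ∂(γ.prod γ) :=
        lintegral_mono key
    _ = ENNReal.ofReal (1 / 2) * ∫⁻ z, A z.swap ∂(γ.prod γ) +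
        ENNReal.ofReal (1 / 2) * ∫⁻ z, B (ContinuousLinearMap.rotation (π / 4) z) ∂(γ.prod γ) := by
        rw [lintegral_add_left (by fun_prop), lintegral_const_mul _ (by fun_prop),
          lintegral_const_mul _ (by fun_prop)]
    _ = ENNReal.ofReal (1 / 2) * ∫⁻ z, A z ∂(γ.prod γ) +
        ENNReal.ofReal (1 / 2) * ∫⁻ z, B z ∂(γ.prod γ) := by
        rw [lintegral_prod_swap A]
        congr 2
        conv_rhs => rw [← map_rotation_stdGaussian, lintegral_map hBm (by fun_prop)]
    _ ≤ ENNReal.ofReal (1 / 2) * ENNReal.ofReal (exp (t ^ 2 * b ^ 2)) +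
        ENNReal.ofReal (1 / 2) * ENNReal.ofReal (exp (t ^ 2 * b ^ 2)) := by
        gcongr
        · refine (lintegral_exp_inner_le hg hb (-t)).trans ?_
          gcongr
          nlinarith [mul_nonneg (sq_nonneg t) (sq_nonneg b)]
        · refine (lintegral_exp_inner_le hg hb (t * √2)).trans_eq ?_
          rw [mul_pow, sq_sqrt (by norm_num)]
          ring_nf
    _ = _ := by
        rw [← add_mul, ← ENNReal.ofReal_add (by norm_num) (by norm_num)]
        norm_num

lemma integrable_exp_seminorm (f : Seminorm ℝ E) (hf : Continuous f) {g : E → E}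
    (hg : Measurable g) (hsub : ∀ x y, f x + ⟪g x, y⟫ ≤ f (x + y)) {b : ℝ}
    (hb : ∀ x, ‖g x‖ ≤ b) (t : ℝ) :
    Integrable (fun x => exp (t * f x)) (ProbabilityTheory.stdGaussian E) := by
  have hfm := hf.measurable
  wlog ht : 0 ≤ t generalizing t
  · refine (this 0 le_rfl).mono' (by fun_prop) (ae_of_all _ fun x => ?_)
    rw [norm_eq_abs, abs_exp, exp_le_exp]
    exact mul_le_mul_of_nonneg_right (le_of_not_ge ht) (apply_nonneg f x)
  have h := lintegral_exp_mul_lintegral_exp_neg_le f hf hg hsub hb (t := 2 * t) (by positivity)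
  refine (lintegral_ofReal_ne_top_iff_integrable (by fun_prop)
    (ae_of_all _ fun x => (exp_pos _).le)).1 fun htop => ?_
  simp only [mul_div_cancel_left₀ t (two_ne_zero' ℝ)] at h
  rw [htop, ENNReal.mul_top] at h
  · exact absurd h (by simp)
  · rw [ne_eq, lintegral_eq_zero_iff (by fun_prop)]
    intro h0
    obtain ⟨x, hx⟩ := h0.exists
    simp only [Pi.zero_apply, ENNReal.ofReal_eq_zero] at hx
    exact absurd hx (not_le.2 (exp_pos _))

lemma integral_exp_mul_integral_exp_neg_le (f : Seminorm ℝ E) (hf : Continuous f) {g : E → E}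
    (hg : Measurable g) (hsub : ∀ x y, f x + ⟪g x, y⟫ ≤ f (x + y)) {b : ℝ}
    (hb : ∀ x, ‖g x‖ ≤ b) {t : ℝ} (ht : 0 ≤ t) :
    (∫ x, exp (-t * f x) ∂(ProbabilityTheory.stdGaussian E)) *
      (∫ x, exp (t / 2 * f x) ∂(ProbabilityTheory.stdGaussian E)) ≤
      exp (t ^ 2 * b ^ 2) := by
  have h := lintegral_exp_mul_lintegral_exp_neg_le f hf hg hsub hb ht
  rw [← ofReal_integral_eq_lintegral_ofReal (integrable_exp_seminorm f hf hg hsub hb _)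
      (ae_of_all _ fun x => (exp_pos _).le),
    ← ofReal_integral_eq_lintegral_ofReal (integrable_exp_seminorm f hf hg hsub hb _)
      (ae_of_all _ fun x => (exp_pos _).le),
    ← ENNReal.ofReal_mul (integral_nonneg fun x => (exp_pos _).le)] at h
  exact (ENNReal.ofReal_le_ofReal_iff (exp_pos _).le).1 h

lemma integrable_seminorm_sq (f : Seminorm ℝ E) (hf : Continuous f) :
    Integrable (fun x => f x ^ 2) (ProbabilityTheory.stdGaussian E) := by
  obtain ⟨C, -, hC⟩ := Seminorm.bound_of_continuous_normedSpace f hf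
  have h2 : Integrable (fun x : E => ‖x‖ ^ 2) (ProbabilityTheory.stdGaussian E) :=
    (IsGaussian.memLp_two_id (μ := ProbabilityTheory.stdGaussian E)).integrable_norm_pow two_ne_zero
  have hfm := hf.measurable
  refine (h2.const_mul (C ^ 2)).mono' (by fun_prop) (ae_of_all _ fun x => ?_)
  rw [norm_pow, norm_eq_abs, abs_of_nonneg (apply_nonneg f x), ← mul_pow]
  exact pow_le_pow_left₀ (apply_nonneg f x) (hC x) 2

lemma exp_le_gaussianReal_Icc {s : ℝ} (hs : 0 ≤ s) :
    exp (-(s + 1) ^ 2 / 2 - 1) ≤ (gaussianReal 0 1).real (Set.Icc s (s + 1)) := by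
  have hnn : 0 ≤ ∫ x in Set.Icc s (s + 1), gaussianPDFReal 0 1 x :=
    integral_nonneg fun x => gaussianPDFReal_nonneg _ _ _
  rw [measureReal_def, gaussianReal_apply_eq_integral _ one_ne_zero, ENNReal.toReal_ofReal hnn]
  have hc : ∫ x in Set.Icc s (s + 1), exp (-(s + 1) ^ 2 / 2 - 1) =
      exp (-(s + 1) ^ 2 / 2 - 1) := by simp
  rw [← hc]
  refine setIntegral_mono_on (by simp) (integrable_gaussianPDFReal _ _).integrableOn
    measurableSet_Icc fun x hx => ?_
  rw [gaussianPDFReal_def]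
  simp only [NNReal.coe_one, mul_one, sub_zero]
  rw [sub_eq_add_neg, exp_add, mul_comm]
  gcongr
  · rw [exp_neg]
    gcongr
    rw [sqrt_le_left (exp_pos _).le]
    nlinarith [pi_lt_d2, exp_one_gt_d9]
  · linarith [hx.1]
  · exact hx.2

lemma indepFun_inner_orthogonal {e : E} (he : ‖e‖ = 1) :
    IndepFun (fun x : E => ⟪e, x⟫) (fun x : E => x - ⟪e, x⟫ • e)
      (ProbabilityTheory.stdGaussian E) := by
  have hG : HasGaussianLaw (fun x : E => (⟪e, x⟫, x - ⟪e, x⟫ • e))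
      (ProbabilityTheory.stdGaussian E) := by
    have := (IsGaussian.hasGaussianLaw_id (μ := ProbabilityTheory.stdGaussian E)).map_fun
      ((innerSL ℝ e).prod (ContinuousLinearMap.id ℝ E - (innerSL ℝ e).smulRight e))
    simpa using this
  refine hG.indepFun_of_covariance_inner fun c y => ?_
  have h1 : (fun x : E => ⟪c, ⟪e, x⟫⟫) = fun x => ⟪c • e, x⟫ := by
    ext x; simp [real_inner_smul_left, mul_comm]
  have h2 : (fun x : E => ⟪y, x - ⟪e, x⟫ • e⟫) = fun x => ⟪y - ⟪e, y⟫ • e, x⟫ := by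
    ext x
    rw [inner_sub_right, inner_sub_left, real_inner_smul_left, real_inner_smul_right,
      real_inner_comm y e]
    ring
  rw [h1, h2, ← covarianceBilin_apply_eq_cov IsGaussian.memLp_two_id, covarianceBilin_stdGaussian,
    innerSL_apply_apply, real_inner_smul_left, inner_sub_right, real_inner_smul_right,
    real_inner_self_eq_norm_sq, he]
  ring

lemma le_integral_seminorm_orthogonal_sq (f : Seminorm ℝ E) (hf : Continuous f)
    (h1 : ∫ x, f x ^ 2 ∂(ProbabilityTheory.stdGaussian E) = 1)
    (hext : ∀ U : E →ₗ[ℝ] E, ∫ x, f (U x) ^ 2 ∂(ProbabilityTheory.stdGaussian E) ≤ 1 →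
      |LinearMap.det U| ≤ 1) {e : E} (he : ‖e‖ = 1) :
    1 - 4 / (Module.finrank ℝ E : ℝ) ≤
      ∫ x, f (x - ⟪e, x⟫ • e) ^ 2 ∂(ProbabilityTheory.stdGaussian E) := by
  set γ := ProbabilityTheory.stdGaussian E
  set n := Module.finrank ℝ E
  have hn : 0 < n := by
    have : Nontrivial E := ⟨e, 0, fun h => by simp [h] at he⟩
    exact Module.finrank_pos
  let P : E →L[ℝ] E := ContinuousLinearMap.id ℝ E - (innerSL ℝ e).smulRight e
  have hP : ∀ x, P x = x - ⟪e, x⟫ • e := fun x => by simp [P]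
  simp only [← hP]
  have hi1 := integrable_seminorm_sq f hf
  have hi2 : Integrable (fun x => f (P x) ^ 2) γ :=
    integrable_seminorm_sq (f.comp (P : E →ₗ[ℝ] E)) (hf.comp P.continuous)
  let T : E →ₗ[ℝ] E := LinearMap.transvection ((innerSL ℝ e : E →L[ℝ] ℝ) : E →ₗ[ℝ] ℝ)
    ((-1 / 2 : ℝ) • e)
  have hT : ∀ x, T x = (1 / 2 : ℝ) • (x + P x) := fun x => by
    simp only [T, hP, LinearMap.transvection.apply, ContinuousLinearMap.coe_coe,
      innerSL_apply_apply]
    module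
  have hdet : LinearMap.det T = 1 / 2 := by
    simp only [T, LinearMap.transvection.det, ContinuousLinearMap.coe_coe, innerSL_apply_apply,
      real_inner_smul_right, real_inner_self_eq_norm_sq, he]
    norm_num
  have hTle : ∀ x, f (T x) ^ 2 ≤ (f x ^ 2 + f (P x) ^ 2) / 2 := fun x => by
    have h : f (T x) ≤ (f x + f (P x)) / 2 := by
      rw [hT, map_smul_eq_mul]
      have := map_add_le_add f x (P x)
      norm_num
      linarith
    have := apply_nonneg f (T x)
    nlinarith [sq_nonneg (f x - f (P x))]
  have hgt : 1 < ∫ x, f ((exp (1 / n) • T) x) ^ 2 ∂γ := by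
    by_contra! hle
    have h := hext _ hle
    rw [LinearMap.det_smul, hdet, ← exp_nat_mul, mul_one_div_cancel (by positivity),
      abs_of_pos (by positivity)] at h
    linarith [exp_one_gt_d9]
  have hle : ∫ x, f ((exp (1 / n) • T) x) ^ 2 ∂γ ≤
      ∫ x, exp (2 / n) * ((f x ^ 2 + f (P x) ^ 2) / 2) ∂γ := by
    refine integral_mono_of_nonneg (ae_of_all _ fun x => sq_nonneg _)
      (((hi1.add hi2).div_const 2).const_mul _) (ae_of_all _ fun x => ?_)
    simp only [LinearMap.smul_apply, map_smul_eq_mul, norm_eq_abs, abs_exp, mul_pow]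
    rw [← exp_nat_mul]
    have : ((2 : ℕ) : ℝ) * (1 / n) = 2 / n := by push_cast; ring
    rw [this]
    exact mul_le_mul_of_nonneg_left (hTle x) (exp_pos _).le
  rw [integral_const_mul, integral_div, integral_add hi1 hi2, h1] at hle
  set q := ∫ x, f (P x) ^ 2 ∂γ
  have h3 : exp (-(2 / n)) < (1 + q) / 2 := by
    have h4 : 1 < exp (2 / n) * ((1 + q) / 2) := hgt.trans_le hle
    rw [exp_neg, inv_lt_iff_one_lt_mul₀ (exp_pos _)]
    linarith
  have h5 := add_one_le_exp (-(2 / n : ℝ))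
  have h6 : (4 / n : ℝ) = 2 * (2 / n) := by ring
  linarith

lemma finrank_mul_exp_le_two (f : Seminorm ℝ E) (hf : Continuous f)
    (h1 : ∫ x, f x ^ 2 ∂(ProbabilityTheory.stdGaussian E) = 1)
    (hext : ∀ U : E →ₗ[ℝ] E, ∫ x, f (U x) ^ 2 ∂(ProbabilityTheory.stdGaussian E) ≤ 1 →
      |LinearMap.det U| ≤ 1) {v : E} (hv0 : v ≠ 0) (hv : ∀ y, |⟪v, y⟫| ≤ f y) :
    (Module.finrank ℝ E : ℝ) * exp (-(3 / ‖v‖ + 1) ^ 2 / 2 - 1) ≤ 2 := by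
  have hn : 0 < Module.finrank ℝ E := by
    have : Nontrivial E := ⟨v, 0, hv0⟩
    exact Module.finrank_pos
  have hvn : 0 < ‖v‖ := norm_pos_iff.2 hv0
  set e : E := ‖v‖⁻¹ • v with he_def
  have he : ‖e‖ = 1 := norm_smul_inv_norm hv0
  have hve : v = ‖v‖ • e := by rw [he_def, smul_smul, mul_inv_cancel₀ hvn.ne', one_smul]
  have hq := le_integral_seminorm_orthogonal_sq f hf h1 hext he
  set γ := ProbabilityTheory.stdGaussian E
  set n := Module.finrank ℝ E
  let P : E →L[ℝ] E := ContinuousLinearMap.id ℝ E - (innerSL ℝ e).smulRight e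
  have hP : ∀ x, P x = x - ⟪e, x⟫ • e := fun x => by simp [P]
  simp only [← hP] at hq
  have hi1 := integrable_seminorm_sq f hf
  have hi2 : Integrable (fun x => f (P x) ^ 2) γ :=
    integrable_seminorm_sq (f.comp (P : E →ₗ[ℝ] E)) (hf.comp P.continuous)
  let R : E ≃ₗᵢ[ℝ] E := (ℝ ∙ e).reflection
  have hR : ∀ x, R x = (2 * ⟪e, x⟫) • e - x := fun x => by
    simp only [R, Submodule.reflection_singleton_apply, he]
    simp [two_smul, two_mul, add_smul]
  have hmR : MeasurePreserving R γ γ := ⟨by fun_prop, stdGaussian_map R⟩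
  have hi3 : Integrable (fun x => f (R x) ^ 2) γ := hmR.integrable_comp_of_integrable hi1
  have hint3 : ∫ x, f (R x) ^ 2 ∂γ = 1 := by
    rw [← h1]
    exact hmR.integral_comp R.toHomeomorph.measurableEmbedding (fun x => f x ^ 2)
  set q := ∫ x, f (P x) ^ 2 ∂γ
  let D : E → ℝ := fun x => f x ^ 2 + f (R x) ^ 2 - 2 * f (P x) ^ 2
  have hD0 : ∀ x, 0 ≤ D x := fun x => by
    have h : f (P x) ≤ (f x + f (R x)) / 2 := by
      have h2 : P x = (1 / 2 : ℝ) • (x - R x) := by rw [hP, hR]; module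
      rw [h2, map_smul_eq_mul]
      have := map_sub_le_add f x (R x)
      norm_num
      linarith
    have := apply_nonneg f (P x)
    simp only [D]
    nlinarith [sq_nonneg (f x - f (R x))]
  have hDi : Integrable D γ := (hi1.add hi3).sub (hi2.const_mul 2)
  have hDint : ∫ x, D x ∂γ = 2 - 2 * q := by
    have hi13 : Integrable (fun x => f x ^ 2 + f (R x) ^ 2) γ := hi1.add hi3
    simp only [D]
    rw [integral_sub hi13 (hi2.const_mul 2), integral_add hi1 hi3, h1, hint3,
      integral_const_mul]
    norm_num
    rfl
  have hq1 : q ≤ 1 := by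
    have : 0 ≤ ∫ x, D x ∂γ := integral_nonneg fun x => hD0 x
    linarith
  set s := 3 / ‖v‖ with hs
  have hs0 : 0 ≤ s := by positivity
  -- the two independent events
  set S₁ : Set E := (fun x => ⟪e, x⟫) ⁻¹' Set.Icc s (s + 1)
  set S₂ : Set E := (fun x => x - ⟪e, x⟫ • e) ⁻¹' {y | f y < 2}
  have hS₂m : MeasurableSet {y | f y < 2} := measurableSet_lt hf.measurable measurable_const
  have hind : γ.real (S₁ ∩ S₂) = γ.real S₁ * γ.real S₂ := by
    simp only [measureReal_def]
    rw [(indepFun_inner_orthogonal he).measure_inter_preimage_eq_mul _ _ measurableSet_Icc hS₂m,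
      ENNReal.toReal_mul]
  have hp1 : exp (-(s + 1) ^ 2 / 2 - 1) ≤ γ.real S₁ := by
    have h2 := map_inner_stdGaussian e
    rw [he] at h2
    have h3 : γ.real S₁ = (γ.map (fun x => ⟪e, x⟫)).real (Set.Icc s (s + 1)) := by
      rw [map_measureReal_apply (by fun_prop) measurableSet_Icc]
    rw [h3, h2]
    simpa using exp_le_gaussianReal_Icc hs0
  have hp2 : 3 / 4 ≤ γ.real S₂ := by
    have hM := mul_meas_ge_le_integral_of_nonneg (ae_of_all γ fun x => sq_nonneg (f (P x))) hi2 4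
    have h2 : S₂ᶜ ⊆ {x | 4 ≤ f (P x) ^ 2} := fun x hx => by
      simp only [S₂, Set.mem_compl_iff, Set.mem_preimage, Set.mem_ofPred_eq, not_lt, ← hP] at hx ⊢
      nlinarith
    have h3 := measureReal_mono h2 (measure_ne_top γ _)
    have h4 : γ.real S₂ᶜ = 1 - γ.real S₂ :=
      probReal_compl_eq_one_sub (hS₂m.preimage (by fun_prop))
    linarith
  have hsub : S₁ ∩ S₂ ⊆ {x | 10 ≤ D x} := by
    rintro x ⟨hx1, hx2⟩
    simp only [S₁, S₂, Set.mem_preimage, Set.mem_ofPred_eq, ← hP, Set.mem_Icc] at hx1 hx2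
    have hvx : 3 ≤ ⟪v, x⟫ := by
      rw [hve, real_inner_smul_left]
      have := mul_le_mul_of_nonneg_left hx1.1 hvn.le
      rwa [hs, mul_div_cancel₀ _ hvn.ne'] at this
    have hvR : ⟪v, R x⟫ = ⟪v, x⟫ := by
      have h2 : ⟪v, e⟫ = ‖v‖ := by
        rw [he_def, real_inner_smul_right, real_inner_self_eq_norm_sq]
        field_simp
      have h3 : ‖v‖ * ⟪e, x⟫ = ⟪v, x⟫ := by
        rw [← real_inner_smul_left, ← hve]
      rw [hR, inner_sub_right, real_inner_smul_right, h2]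
      linarith
    have h2 : 3 ≤ f x := hvx.trans ((le_abs_self _).trans (hv x))
    have h3 : 3 ≤ f (R x) := by
      have := (le_abs_self _).trans (hv (R x))
      linarith
    have h4 := apply_nonneg f (P x)
    simp only [Set.mem_ofPred_eq, D]
    nlinarith
  have hMD := mul_meas_ge_le_integral_of_nonneg (ae_of_all γ hD0) hDi 10
  have h2 := measureReal_mono hsub (measure_ne_top γ _)
  have h3 : exp (-(s + 1) ^ 2 / 2 - 1) * (3 / 4) ≤ γ.real S₁ * γ.real S₂ := by gcongr
  have h4 : exp (-(s + 1) ^ 2 / 2 - 1) ≤ 2 / n := by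
    have h5 : (8 : ℝ) / n = 2 * (4 / n) := by ring
    have h6 : (2 : ℝ) / n = (4 / n) / 2 := by ring
    have h7 : (0 : ℝ) ≤ 4 / n := by positivity
    rw [hind] at h2
    change 10 * γ.real {x | 10 ≤ D x} ≤ ∫ x, D x ∂γ at hMD
    rw [hDint] at hMD
    linarith
  rw [le_div_iff₀ (by positivity)] at h4
  linarith

lemma norm_sq_mul_log_finrank_le (f : Seminorm ℝ E) (hf : Continuous f)
    (h1 : ∫ x, f x ^ 2 ∂(ProbabilityTheory.stdGaussian E) = 1)
    (hext : ∀ U : E →ₗ[ℝ] E, ∫ x, f (U x) ^ 2 ∂(ProbabilityTheory.stdGaussian E) ≤ 1 →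
      |LinearMap.det U| ≤ 1) (hL : 10 ≤ log (Module.finrank ℝ E))
    {v : E} (hv : ∀ y, |⟪v, y⟫| ≤ f y) :
    ‖v‖ ^ 2 * log (Module.finrank ℝ E) ≤ 36 := by
  rcases eq_or_ne v 0 with rfl | hv0
  · simp
  have h := finrank_mul_exp_le_two f hf h1 hext hv0 hv
  have hn : 0 < Module.finrank ℝ E := by
    have : Nontrivial E := ⟨v, 0, hv0⟩
    exact Module.finrank_pos
  have hvn : 0 < ‖v‖ := norm_pos_iff.2 hv0
  set n := Module.finrank ℝ E
  set s := 3 / ‖v‖ with hs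
  have hs0 : 0 ≤ s := by positivity
  have h2 : log n + (-(s + 1) ^ 2 / 2 - 1) ≤ log 2 := by
    have := log_le_log (by positivity) h
    rwa [log_mul (by positivity) (exp_pos _).ne', log_exp] at this
  have h3 : log n ≤ 4 * s ^ 2 := by
    have := log_two_lt_d9
    nlinarith [sq_nonneg (s - 1)]
  have h4 : ‖v‖ ^ 2 * s ^ 2 = 9 := by
    rw [hs]; field_simp; norm_num
  nlinarith [mul_le_mul_of_nonneg_left h3 (sq_nonneg ‖v‖)]

lemma exp_integral_le {α : Type*} [MeasurableSpace α] {μ : Measure α} [IsProbabilityMeasure μ]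
    {h : α → ℝ} (hh : Integrable h μ) (he : Integrable (fun x => exp (h x)) μ) :
    exp (∫ x, h x ∂μ) ≤ ∫ x, exp (h x) ∂μ := by
  set m := ∫ x, h x ∂μ with hm
  have hs : Integrable (fun x => h x - m) μ := hh.sub (integrable_const m)
  have hi : Integrable (fun x => exp m * (h x - m + 1)) μ :=
    (hs.add (integrable_const 1)).const_mul _
  have h1 : ∫ x, exp m * (h x - m + 1) ∂μ = exp m := by
    rw [integral_const_mul, integral_add hs (integrable_const 1),
      integral_sub hh (integrable_const m)]
    simp [← hm]
  rw [← h1]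
  refine integral_mono hi he fun x => ?_
  have h2 : exp (h x) = exp m * exp (h x - m) := by rw [← exp_add]; ring_nf
  simp only [h2]
  exact mul_le_mul_of_nonneg_left (add_one_le_exp _) (exp_pos _).le

lemma sq_integral_le_integral_sq {α : Type*} [MeasurableSpace α] {μ : Measure α}
    [IsProbabilityMeasure μ] {h : α → ℝ} (hh : Integrable h μ)
    (hh2 : Integrable (fun x => h x ^ 2) μ) :
    (∫ x, h x ∂μ) ^ 2 ≤ ∫ x, h x ^ 2 ∂μ := by
  set m := ∫ x, h x ∂μ with hm
  have hi : Integrable (fun x => 2 * m * h x - m ^ 2) μ :=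
    (hh.const_mul _).sub (integrable_const _)
  have h1 : ∫ x, (2 * m * h x - m ^ 2) ∂μ = m ^ 2 := by
    rw [integral_sub (hh.const_mul _) (integrable_const _), integral_const_mul, ← hm]
    simp
    ring
  rw [← h1]
  refine integral_mono hi hh2 fun x => ?_
  simp only
  nlinarith [sq_nonneg (h x - m)]

lemma integral_rpow_le_of_ellPosition (f : Seminorm ℝ E) (hf : Continuous f) {g : E → E}
    (hg : Measurable g) (hsub : ∀ x y, f x + ⟪g x, y⟫ ≤ f (x + y))
    (h1 : ∫ x, f x ^ 2 ∂(ProbabilityTheory.stdGaussian E) = 1)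
    (hext : ∀ U : E →ₗ[ℝ] E, ∫ x, f (U x) ^ 2 ∂(ProbabilityTheory.stdGaussian E) ≤ 1 →
      |LinearMap.det U| ≤ 1) {L : ℝ} (hLdef : L = log (Module.finrank ℝ E)) (hL : 10 ^ 7 ≤ L)
    (hgrad : ∫ x, f x ∂(ProbabilityTheory.stdGaussian E) ≤
      exp (L / 500000) * ∫ x, ‖g x‖ ∂(ProbabilityTheory.stdGaussian E))
    {p : ℝ} (hp1 : 1 ≤ p) (hp : p ≤ L / 500000) :
    ∫ x, f x ^ (2 * p) ∂(ProbabilityTheory.stdGaussian E) ≤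
      exp (L / 32) *
        ∫ x, f x ^ (2 * p - 2) * ‖g x‖ ^ 2 ∂(ProbabilityTheory.stdGaussian E) := by
  have hfm := hf.measurable
  have hL0 : 0 < L := by linarith
  have hf0 : ∀ x, 0 ≤ f x := fun x => apply_nonneg f x
  have hgf : ∀ x y, ⟪g x, y⟫ ≤ f y := fun x y => by
    linarith [hsub x y, map_add_le_add f x y]
  have habs : ∀ x y, |⟪g x, y⟫| ≤ f y := fun x y => by
    refine abs_le.2 ⟨?_, hgf x y⟩
    have := hgf x (-y)
    rw [inner_neg_right, map_neg_eq_map] at this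
    linarith
  set b : ℝ := 6 / √L with hb_def
  have hbsq : b ^ 2 = 36 / L := by
    rw [hb_def, div_pow, sq_sqrt hL0.le]; norm_num
  have hb : ∀ x, ‖g x‖ ≤ b := fun x => by
    have h := norm_sq_mul_log_finrank_le f hf h1 hext (by rw [← hLdef]; linarith) (habs x)
    rw [← hLdef, ← le_div_iff₀ hL0, ← hbsq] at h
    exact le_of_sq_le_sq h (by positivity)
  have hg1 : ∀ x, ‖g x‖ ≤ 1 := fun x => by
    refine (hb x).trans (le_of_sq_le_sq ?_ zero_le_one)
    rw [hbsq, one_pow, div_le_one hL0]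
    linarith
  set γ := ProbabilityTheory.stdGaussian E
  have hexp : ∀ t, Integrable (fun x => exp (t * f x)) γ :=
    integrable_exp_seminorm f hf hg hsub hb
  have hconc : ∀ t, 0 ≤ t → (∫ x, exp (-t * f x) ∂γ) * (∫ x, exp (t / 2 * f x) ∂γ) ≤
      exp (36 * t ^ 2 / L) := fun t ht => by
    refine (integral_exp_mul_integral_exp_neg_le f hf hg hsub hb ht).trans_eq ?_
    rw [hbsq]; ring_nf
  have hfi : Integrable f γ := by
    refine (hexp 1).mono' (by fun_prop) (ae_of_all _ fun x => ?_)
    rw [norm_eq_abs, abs_of_nonneg (hf0 x), one_mul]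
    linarith [add_one_le_exp (f x)]
  have hf2 := integrable_seminorm_sq f hf
  set m := ∫ x, f x ∂γ with hm
  have hjensen : ∀ t, exp (t * m) ≤ ∫ x, exp (t * f x) ∂γ := fun t => by
    have := exp_integral_le (hfi.const_mul t) (hexp t)
    rwa [integral_const_mul] at this
  have hm1 : m ≤ 1 := by
    have := sq_integral_le_integral_sq hfi hf2
    rw [h1] at this
    nlinarith
  -- bounds on exponential moments in terms of the mean
  have hup : ∀ t, 0 ≤ t → ∫ x, exp (t / 2 * f x) ∂γ ≤ exp (36 * t ^ 2 / L + t * m) := by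
    intro t ht
    have h2 := hconc t ht
    have h3 := hjensen (-t)
    have h4 : exp (-t * m) * ∫ x, exp (t / 2 * f x) ∂γ ≤ exp (36 * t ^ 2 / L) :=
      (mul_le_mul_of_nonneg_right h3 (integral_nonneg fun x => (exp_pos _).le)).trans h2
    rw [exp_add]
    calc _ = (exp (-t * m) * ∫ x, exp (t / 2 * f x) ∂γ) * exp (t * m) := by
          rw [mul_right_comm, ← exp_add]; simp
      _ ≤ _ := by gcongr
  have hlow : ∀ t, 0 ≤ t → ∫ x, exp (-t * f x) ∂γ ≤ exp (36 * t ^ 2 / L - t / 2 * m) := by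
    intro t ht
    have h2 := hconc t ht
    have h3 := hjensen (t / 2)
    have h4 : (∫ x, exp (-t * f x) ∂γ) * exp (t / 2 * m) ≤ exp (36 * t ^ 2 / L) :=
      (mul_le_mul_of_nonneg_left h3 (integral_nonneg fun x => (exp_pos _).le)).trans h2
    rw [exp_sub, le_div_iff₀ (exp_pos _)]
    exact h4
  have hm10 : 1 / 10 ≤ m := by
    have h2 := hup 4 (by norm_num)
    have h3 : 2 ≤ ∫ x, exp (4 / 2 * f x) ∂γ := by
      have : ∫ x, 2 * f x ^ 2 ∂γ = 2 := by rw [integral_const_mul, h1, mul_one]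
      refine this.symm.le.trans (integral_mono (hf2.const_mul 2) (hexp _) fun x => ?_)
      have := quadratic_le_exp_of_nonneg (x := 4 / 2 * f x) (by linarith [hf0 x])
      simp only
      nlinarith [hf0 x]
    have h4 := log_le_log (by norm_num) (h3.trans h2)
    rw [log_exp] at h4
    have h5 : 36 * (4 : ℝ) ^ 2 / L ≤ 1 / 100 := by
      rw [div_le_iff₀ hL0]; linarith
    linarith [log_two_gt_d9]
  have hmom : ∫ x, f x ^ (2 * p) ∂γ ≤ exp (5 * p) := by
    have h2 : ∫ x, f x ^ (2 * p) ∂γ ≤ ∫ x, exp (4 * p / 2 * f x) ∂γ := by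
      refine integral_mono_of_nonneg (ae_of_all _ fun x => rpow_nonneg (hf0 x) _) (hexp _)
        (ae_of_all _ fun x => ?_)
      calc f x ^ (2 * p) ≤ exp (f x) ^ (2 * p) :=
            rpow_le_rpow (hf0 x) (by linarith [add_one_le_exp (f x)]) (by linarith)
        _ = exp (4 * p / 2 * f x) := by rw [← exp_mul]; ring_nf
    refine h2.trans ((hup (4 * p) (by linarith)).trans (exp_le_exp.2 ?_))
    have h3 : 36 * (4 * p) ^ 2 / L ≤ p := by
      rw [div_le_iff₀ hL0]; nlinarith
    nlinarith
  -- small ball estimate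
  set A : Set E := {x | m / 4 ≤ f x} with hA
  have hAm : MeasurableSet A := measurableSet_le measurable_const hfm
  have hball : γ.real Aᶜ ≤ exp (-L / 230400) := by
    set t := m * L / 288 with ht
    have ht0 : 0 ≤ t := by positivity
    have hM := mul_meas_ge_le_integral_of_nonneg
      (ae_of_all γ fun x => (exp_pos (-t * f x)).le) (hexp (-t)) (exp (-t * (m / 4)))
    have hsubset : Aᶜ ⊆ {x | exp (-t * (m / 4)) ≤ exp (-t * f x)} := fun x hx => by
      simp only [hA, Set.mem_compl_iff, Set.mem_ofPred_eq, not_le] at hx ⊢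
      rw [exp_le_exp]
      nlinarith
    have h2 := measureReal_mono hsubset (measure_ne_top γ _)
    have h3 : exp (-t * (m / 4)) * γ.real Aᶜ ≤ exp (36 * t ^ 2 / L - t / 2 * m) :=
      (mul_le_mul_of_nonneg_left h2 (exp_pos _).le).trans (hM.trans (hlow t ht0))
    calc γ.real Aᶜ = exp (t * (m / 4)) * (exp (-t * (m / 4)) * γ.real Aᶜ) := by
          rw [← mul_assoc, ← exp_add]; simp
      _ ≤ exp (t * (m / 4)) * exp (36 * t ^ 2 / L - t / 2 * m) := by gcongr
      _ = exp (-(m ^ 2 * L / 2304)) := by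
          rw [← exp_add]; congr 1; rw [ht]; field_simp; ring
      _ ≤ exp (-L / 230400) := by
          rw [exp_le_exp]
          have h4 : (1 / 100 : ℝ) ≤ m ^ 2 := by nlinarith
          nlinarith
  -- the gradient is not small on average where the norm is not small
  set h : E → ℝ := A.indicator fun x => ‖g x‖ with hh
  have hgi : Integrable (fun x => ‖g x‖) γ :=
    (integrable_const (1 : ℝ)).mono' (by fun_prop) (ae_of_all _ fun x => by simpa using hg1 x)
  have hhi : Integrable h γ := hgi.indicator hAm
  have hh0 : ∀ x, 0 ≤ h x := fun x => Set.indicator_nonneg (fun x _ => norm_nonneg _) x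
  have hhle : ∀ x, h x ≤ ‖g x‖ := fun x => Set.indicator_le_self' (fun x _ => norm_nonneg _) x
  have hh1 : ∀ x, h x ≤ 1 := fun x => (hhle x).trans (hg1 x)
  have hhm : Measurable h := hg.norm.indicator hAm
  have hhi2 : Integrable (fun x => h x ^ 2) γ :=
    (integrable_const (1 : ℝ)).mono' (by fun_prop) (ae_of_all _ fun x => by
      rw [norm_eq_abs, abs_of_nonneg (sq_nonneg _)]
      exact pow_le_one₀ (hh0 x) (hh1 x))
  have hsplit : ∫ x, ‖g x‖ ∂γ ≤ (∫ x, h x ∂γ) + γ.real Aᶜ := by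
    have hi : Integrable (Aᶜ.indicator (fun _ => (1 : ℝ))) γ :=
      (integrable_const 1).indicator hAm.compl
    have h2 : ∫ x, Aᶜ.indicator (fun _ => (1 : ℝ)) x ∂γ = γ.real Aᶜ := by
      rw [integral_indicator_const _ hAm.compl]; simp
    rw [← h2, ← integral_add hhi hi]
    refine integral_mono hgi (hhi.add hi) fun x => ?_
    by_cases hx : x ∈ A
    · simp [hh, hx]
    · simpa [hh, hx] using hg1 x
  have hJ : exp (-(L / 500000)) / 20 ≤ ∫ x, h x ∂γ := by
    have h2 : m ≤ exp (L / 500000) * ((∫ x, h x ∂γ) + exp (-L / 230400)) := by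
      refine hgrad.trans ?_
      gcongr
      linarith
    have h3 : exp (-(L / 500000)) * m ≤ (∫ x, h x ∂γ) + exp (-L / 230400) := by
      have := mul_le_mul_of_nonneg_left h2 (exp_pos (-(L / 500000))).le
      rwa [← mul_assoc, ← exp_add, neg_add_cancel, exp_zero, one_mul] at this
    have h4 : exp (-L / 230400) ≤ exp (-(L / 500000)) / 20 := by
      rw [le_div_iff₀ (by norm_num)]
      have h5 : (20 : ℝ) ≤ exp (L / 230400 - L / 500000) := by
        linarith [add_one_le_exp (L / 230400 - L / 500000)]
      calc exp (-L / 230400) * 20 ≤ exp (-L / 230400) * exp (L / 230400 - L / 500000) := by gcongr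
        _ = _ := by rw [← exp_add]; ring_nf
    nlinarith [exp_pos (-(L / 500000))]
  have hRi : Integrable (fun x => f x ^ (2 * p - 2) * ‖g x‖ ^ 2) γ := by
    refine (hexp (2 * p - 2)).mono' (by fun_prop) (ae_of_all _ fun x => ?_)
    have h2 : f x ^ (2 * p - 2) ≤ exp ((2 * p - 2) * f x) := by
      calc f x ^ (2 * p - 2) ≤ exp (f x) ^ (2 * p - 2) :=
            rpow_le_rpow (hf0 x) (by linarith [add_one_le_exp (f x)]) (by linarith)
        _ = _ := by rw [← exp_mul]; ring_nf
    have h3 := rpow_nonneg (hf0 x) (2 * p - 2)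
    rw [norm_eq_abs, abs_of_nonneg (by positivity)]
    exact (mul_le_of_le_one_right h3 (pow_le_one₀ (norm_nonneg _) (hg1 x))).trans h2
  have hR : (m / 4) ^ (2 * p - 2) * (∫ x, h x ∂γ) ^ 2 ≤
      ∫ x, f x ^ (2 * p - 2) * ‖g x‖ ^ 2 ∂γ := by
    have hm4 : 0 ≤ (m / 4) ^ (2 * p - 2) := rpow_nonneg (by linarith) _
    refine (mul_le_mul_of_nonneg_left (sq_integral_le_integral_sq hhi hhi2) hm4).trans ?_
    rw [← integral_const_mul]
    refine integral_mono (hhi2.const_mul _) hRi fun x => ?_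
    by_cases hx : x ∈ A
    · simp only [hh, hx, Set.indicator_of_mem]
      gcongr
      · linarith
      · exact hx
    · simp only [hh, hx, not_false_eq_true, Set.indicator_of_notMem]
      have h3 := rpow_nonneg (hf0 x) (2 * p - 2)
      simp only [ne_eq, OfNat.ofNat_ne_zero, not_false_eq_true, zero_pow, mul_zero]
      positivity
  have hm4 : exp (-(8 * p)) ≤ (m / 4) ^ (2 * p - 2) := by
    have h2 : exp (-4) ≤ m / 4 := by
      rw [exp_neg, inv_le_comm₀ (exp_pos _) (by linarith)]
      have h3 : (40 : ℝ) ≤ exp 4 := by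
        have h4 : exp 4 = exp 1 ^ 4 := by rw [← exp_nat_mul]; norm_num
        rw [h4]
        calc (40 : ℝ) ≤ 2.7 ^ 4 := by norm_num
          _ ≤ _ := by gcongr; linarith [exp_one_gt_d9]
      refine le_trans ?_ h3
      rw [inv_le_comm₀ (by linarith) (by norm_num)]
      linarith
    calc exp (-(8 * p)) ≤ exp (-4 * (2 * p - 2)) := exp_le_exp.2 (by linarith)
      _ = exp (-4) ^ (2 * p - 2) := exp_mul _ _
      _ ≤ _ := rpow_le_rpow (exp_pos _).le h2 (by linarith)
  calc ∫ x, f x ^ (2 * p) ∂γ ≤ exp (5 * p) := hmom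
    _ ≤ exp (L / 32) * (exp (-(8 * p)) * (exp (-(L / 500000)) / 20) ^ 2) := by
      have h2 : (400 : ℝ) ≤ exp (L / 32 - 13 * p - 2 * (L / 500000)) := by
        linarith [add_one_le_exp (L / 32 - 13 * p - 2 * (L / 500000))]
      have h3 : exp (L / 32) * (exp (-(8 * p)) * (exp (-(L / 500000)) / 20) ^ 2) =
          exp (5 * p) * exp (L / 32 - 13 * p - 2 * (L / 500000)) / 400 := by
        rw [div_pow, ← exp_nat_mul, ← exp_add, mul_div_assoc', mul_div_assoc', ← exp_add,
          ← exp_add]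
        norm_num
        ring_nf
      rw [h3, le_div_iff₀ (by norm_num)]
      gcongr
    _ ≤ exp (L / 32) * ((m / 4) ^ (2 * p - 2) * (∫ x, h x ∂γ) ^ 2) := by gcongr
    _ ≤ _ := by gcongr

end GaussianConcentration

lemma add_inner_gradient_le (E : Type*) [NormedAddCommGroup E] [InnerProductSpace ℝ E]
    [CompleteSpace E] (f : Seminorm ℝ E) {x v : E} (h : HasGradientAt f v x) (y : E) :
    f x + ⟪v, y⟫ ≤ f (x + y) := by
  have hc : ConvexOn ℝ Set.univ fun t : ℝ => f (x + t • y) := by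
    have := f.convexOn.comp_affineMap (AffineMap.lineMap (k := ℝ) x (x + y))
    simpa [Function.comp_def, AffineMap.lineMap_apply, add_comm] using this
  have hd : HasDerivAt (fun t : ℝ => f (x + t • y)) ⟪v, y⟫ 0 := by
    have h1 : HasDerivAt (fun t : ℝ => x + t • y) y 0 := by
      simpa using ((hasDerivAt_id (0 : ℝ)).smul_const y).const_add x
    have h2 : HasFDerivAt f (InnerProductSpace.toDual ℝ E v) (x + (0 : ℝ) • y) := by
      simpa using h.hasFDerivAt
    have h3 := h2.comp_hasDerivAt (0 : ℝ) h1
    simpa [Function.comp_def] using h3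
  have := hc.le_slope_of_hasDerivAt (Set.mem_univ 0) (Set.mem_univ 1) one_pos hd
  simp [slope_def_field] at this
  linarith

lemma stdGaussian_eq (n : ℕ) :
    _root_.stdGaussian n = ProbabilityTheory.stdGaussian (Euc n) :=
  map_pi_eq_stdGaussian

lemma stdGaussian_singleton_zero {E : Type*} [NormedAddCommGroup E] [InnerProductSpace ℝ E]
    [FiniteDimensional ℝ E] [Nontrivial E] [MeasurableSpace E] [BorelSpace E] :
    ProbabilityTheory.stdGaussian E {0} = 0 := by
  obtain ⟨v, hv⟩ := exists_ne (0 : E)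
  refine measure_mono_null (t := (fun x => ⟪v, x⟫) ⁻¹' {0}) (by simp) ?_
  rw [← Measure.map_apply (by fun_prop) (measurableSet_singleton 0), map_inner_stdGaussian]
  have := nullSingletonClass_gaussianReal (μ := 0) (v := (‖v‖ ^ 2).toNNReal) (by simpa using hv)
  exact measure_singleton 0

/-- **Norm-to-gradient moment comparison in the ℓ-position**: if
`E‖G‖_B ≤ n^c · E‖grad_B(G)‖₂`, then for all `p ∈ [1, c·log n]`,
`E‖G‖_B^{2p} ≤ n^{1/32} · p² · E(‖G‖_B^{2p−2}·‖grad_B(G)‖₂²)`. -/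
theorem norm_to_gradient :
    ∃ (n₀ : ℕ) (c : ℝ), 0 < c ∧ ∀ n : ℕ, n₀ ≤ n →
      ∀ B : Set (Euc n), IsSymmConvexBody B → IsEllPosition B →
      ∀ gradB : Euc n → Euc n,
        (∀ x : Euc n, x ≠ 0 → HasGradientAt (gauge B) (gradB x) x) →
        (∫ x, gauge B x ∂stdGaussian n) ≤
          (n : ℝ) ^ c * ∫ x, ‖gradB x‖ ∂stdGaussian n →
      ∀ p : ℝ, 1 ≤ p → p ≤ c * Real.log n →
        (∫ x, gauge B x ^ (2 * p) ∂stdGaussian n) ≤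
          (n : ℝ) ^ ((1 : ℝ) / 32) * p ^ 2 *
            ∫ x, gauge B x ^ (2 * p - 2) * ‖gradB x‖ ^ 2 ∂stdGaussian n := by
  refine ⟨⌈exp (10 ^ 7)⌉₊, 1 / 500000, by norm_num, ?_⟩
  intro n hn B hB hpos gradB hgrad hcomp p hp1 hp
  obtain ⟨hBc, hBconv, hB0, hBsymm⟩ := hB
  have hnexp : exp (10 ^ 7) ≤ n := Nat.ceil_le.1 hn
  have hn0 : (0 : ℝ) < n := (exp_pos _).trans_le hnexp
  have hL : 10 ^ 7 ≤ log n := (le_log_iff_exp_le hn0).2 hnexp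
  have : NeZero n := ⟨by rintro rfl; simp at hn0⟩
  have hnhds : B ∈ nhds (0 : Euc n) := mem_interior_iff_mem_nhds.1 hB0
  let f : Seminorm ℝ (Euc n) := gaugeSeminorm (𝕜 := ℝ)
    ((balanced_iff_neg_mem hBconv).2 fun x hx => hBsymm x hx) hBconv
    (absorbent_nhds_zero hnhds)
  have hfB : ∀ x, gauge B x = f x := fun x => rfl
  have hf : Continuous f := continuous_gauge hBconv hnhds
  have hgrad' : ∀ x : Euc n, x ≠ 0 → HasGradientAt f (gradB x) x := hgrad
  have hgm : Measurable (gradient f) :=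
    ((InnerProductSpace.toDual ℝ (Euc n)).symm.continuous.measurable).comp (measurable_fderiv ℝ f)
  have hsub : ∀ x y, f x + ⟪gradient f x, y⟫ ≤ f (x + y) := by
    intro x y
    by_cases hd : DifferentiableAt ℝ f x
    · exact add_inner_gradient_le _ f hd.hasGradientAt y
    · have hx : x = 0 := by
        by_contra hx
        exact hd (hgrad' x hx).differentiableAt
      subst hx
      rw [gradient_eq_zero_of_not_differentiableAt hd]
      simp
  have hae : ∀ᵐ x ∂(ProbabilityTheory.stdGaussian (Euc n)), gradB x = gradient f x := by
    have h0 : ∀ᵐ x ∂(ProbabilityTheory.stdGaussian (Euc n)), x ≠ 0 := by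
      rw [ae_iff]; simpa using! stdGaussian_singleton_zero (E := Euc n)
    filter_upwards [h0] with x hx
    exact (hgrad' x hx).gradient.symm
  obtain ⟨h1, hext⟩ := hpos
  rw [stdGaussian_eq] at *
  simp only [hfB] at *
  have hI1 : ∫ x, ‖gradB x‖ ∂(ProbabilityTheory.stdGaussian (Euc n)) =
      ∫ x, ‖gradient f x‖ ∂(ProbabilityTheory.stdGaussian (Euc n)) :=
    integral_congr_ae (hae.mono fun x hx => by simp only [hx])
  have hI2 : ∫ x, f x ^ (2 * p - 2) * ‖gradB x‖ ^ 2 ∂(ProbabilityTheory.stdGaussian (Euc n)) =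
      ∫ x, f x ^ (2 * p - 2) * ‖gradient f x‖ ^ 2 ∂(ProbabilityTheory.stdGaussian (Euc n)) :=
    integral_congr_ae (hae.mono fun x hx => by simp only [hx])
  have hpow : ∀ a : ℝ, (n : ℝ) ^ a = exp (log n * a) := fun a => rpow_def_of_pos hn0 a
  rw [hI1, hpow, mul_one_div] at hcomp
  rw [hI2, hpow, mul_one_div]
  have key := integral_rpow_le_of_ellPosition f hf hgm hsub h1 hext (L := log n) (by simp) hL
    hcomp hp1 (by linarith)
  refine key.trans ?_
  have hnn : 0 ≤ ∫ x, f x ^ (2 * p - 2) * ‖gradient f x‖ ^ 2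
      ∂(ProbabilityTheory.stdGaussian (Euc n)) :=
    integral_nonneg fun x => mul_nonneg (rpow_nonneg (apply_nonneg f x) _) (sq_nonneg _)
  gcongr
  exact le_mul_of_one_le_right (exp_pos _).le (one_le_pow₀ hp1)
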